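/- Let v : ℝ² → ℝ be a continuous function with v(0,0) = 0. Then the binary operation on ℝ³ defined by (x₁,y₁,z₁) ∗ (x₂,y₂,z₂) = (x₁+x₂, y₁+y₂ − x₂·v(x₁,z₁), z₁+z₂) is a topological loop multiplication with identity (0,0,0): the operation is continuous, (0,0,0) is a two-sided identity, and for all a, b ∈ ℝ³ each of the equations a ∗ y = b and x ∗ a = b has exactly one solution. -/

import Mathlib

/-- The loop multiplication on `ℝ³` determined by a continuous function `v : ℝ² → ℝ`:
`(x₁,y₁,z₁) ∗ (x₂,y₂,z₂) = (x₁+x₂, y₁+y₂ − x₂·v(x₁,z₁), z₁+z₂)`. -/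
noncomputable def loopMul (v : ℝ × ℝ → ℝ) (p q : ℝ × ℝ × ℝ) : ℝ × ℝ × ℝ :=
  (p.1 + q.1, p.2.1 + q.2.1 - q.1 * v (p.1, p.2.2), p.2.2 + q.2.2)

/-- For every continuous `v : ℝ² → ℝ` with `v(0,0) = 0` the operation `loopMul v` is a
topological loop multiplication on `ℝ³` with identity `(0,0,0)`: it is continuous,
`(0,0,0)` is a two-sided identity, and the equations `a ∗ y = b` and `x ∗ a = b` have
exactly one solution for all `a, b`. -/
theorem loopMul_is_topological_loop (v : ℝ × ℝ → ℝ) (hv : Continuous v)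
    (hv0 : v (0, 0) = 0) :
    Continuous (fun p : (ℝ × ℝ × ℝ) × (ℝ × ℝ × ℝ) => loopMul v p.1 p.2) ∧
    (∀ a : ℝ × ℝ × ℝ, loopMul v (0, 0, 0) a = a ∧ loopMul v a (0, 0, 0) = a) ∧
    (∀ a b : ℝ × ℝ × ℝ,
      (∃! y : ℝ × ℝ × ℝ, loopMul v a y = b) ∧ (∃! x : ℝ × ℝ × ℝ, loopMul v x a = b)) := by
  refine ⟨by unfold loopMul; fun_prop, fun a => ⟨?_, ?_⟩, fun a b => ⟨?_, ?_⟩⟩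
  · simp [loopMul, hv0]
  · simp [loopMul]
  · obtain ⟨a₁, a₂, a₃⟩ := a
    obtain ⟨b₁, b₂, b₃⟩ := b
    refine ⟨(b₁ - a₁, b₂ - a₂ + (b₁ - a₁) * v (a₁, a₃), b₃ - a₃), ?_, ?_⟩
    · simp only [loopMul, Prod.mk.injEq]
      refine ⟨?_, ?_, ?_⟩ <;> ring
    · rintro ⟨y₁, y₂, y₃⟩ h
      simp only [loopMul, Prod.mk.injEq] at h
      obtain ⟨rfl, rfl, rfl⟩ := h
      ext <;> simp only <;> ring
  · obtain ⟨a₁, a₂, a₃⟩ := a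
    obtain ⟨b₁, b₂, b₃⟩ := b
    refine ⟨(b₁ - a₁, b₂ - a₂ + a₁ * v (b₁ - a₁, b₃ - a₃), b₃ - a₃), ?_, ?_⟩
    · simp only [loopMul, Prod.mk.injEq]
      refine ⟨?_, ?_, ?_⟩ <;> ring
    · rintro ⟨x₁, x₂, x₃⟩ h
      simp only [loopMul, Prod.mk.injEq] at h
      obtain ⟨rfl, rfl, rfl⟩ := h
      simp only [add_sub_cancel_right, Prod.mk.injEq, true_and, and_true]
      ring
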